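/- Let T > 0 and μ, σ, ν > 0, and let K ⊂ ℝ³ be compact. Let H, u : [0,T] × ℝ³ → ℝ³ and p : [0,T] × ℝ³ → ℝ be smooth functions whose spatial supports are contained in K for every t ∈ [0,T], and suppose they satisfy the incompressible MHD system with zero sources at every point of [0,T] × ℝ³: (i) μ ∂ₜH + σ⁻¹ ∇×(∇×H) − μ ∇×(u×H) = 0; (ii) ∂ₜu + (u·∇)u − νΔu + ∇p = −μ H×(∇×H); (iii) ∇·u = 0. Then the total energy is nonincreasing: the function t ↦ (μ/2)∫_{ℝ³}|H(t,x)|² dx + (1/2)∫_{ℝ³}|u(t,x)|² dx is antitone (monotone nonincreasing) on [0,T]. -/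

import Mathlib

open MeasureTheory

/-- `∂ⱼ F` at `x`: the `j`-th partial derivative of a vector field `F : ℝ³ → ℝ³`. -/
noncomputable def pd3 (F : (Fin 3 → ℝ) → (Fin 3 → ℝ)) (j : Fin 3)
    (x : Fin 3 → ℝ) : Fin 3 → ℝ :=
  fderiv ℝ F x (Pi.single j 1)

/-- `∂ⱼ g` at `x` for a scalar function `g : ℝ³ → ℝ`. -/
noncomputable def pds3 (g : (Fin 3 → ℝ) → ℝ) (j : Fin 3) (x : Fin 3 → ℝ) : ℝ :=
  fderiv ℝ g x (Pi.single j 1)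

/-- The curl `∇×F = (∂₂F₃ − ∂₃F₂, ∂₃F₁ − ∂₁F₃, ∂₁F₂ − ∂₂F₁)` (0-indexed). -/
noncomputable def curl3 (F : (Fin 3 → ℝ) → (Fin 3 → ℝ)) (x : Fin 3 → ℝ) : Fin 3 → ℝ :=
  ![pd3 F 1 x 2 - pd3 F 2 x 1,
    pd3 F 2 x 0 - pd3 F 0 x 2,
    pd3 F 0 x 1 - pd3 F 1 x 0]

/-- The divergence `∇·F = ∂₁F₁ + ∂₂F₂ + ∂₃F₃`. -/
noncomputable def div3 (F : (Fin 3 → ℝ) → (Fin 3 → ℝ)) (x : Fin 3 → ℝ) : ℝ :=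
  ∑ j, pd3 F j x j

/-- The componentwise Laplacian `(ΔF)_i = Σ_j ∂_j ∂_j F_i`. -/
noncomputable def lap3 (F : (Fin 3 → ℝ) → (Fin 3 → ℝ)) (x : Fin 3 → ℝ) (i : Fin 3) : ℝ :=
  ∑ j, pd3 (fun y => pd3 F j y) j x i

/-- The pointwise cross product in `ℝ³`. -/
def cross3 (a b : Fin 3 → ℝ) : Fin 3 → ℝ :=
  ![a 1 * b 2 - a 2 * b 1,
    a 2 * b 0 - a 0 * b 2,
    a 0 * b 1 - a 1 * b 0]

open scoped ContDiff

section VectorCalculus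

variable {A B F G : (Fin 3 → ℝ) → (Fin 3 → ℝ)} {f : (Fin 3 → ℝ) → ℝ} {x : Fin 3 → ℝ}

lemma pd3_apply (hF : DifferentiableAt ℝ F x) (i j : Fin 3) :
    pd3 F j x i = pds3 (fun y => F y i) j x := by
  simp only [pd3, pds3]
  rw [fderiv_apply hF]
  rfl

lemma pds3_mul {f g : (Fin 3 → ℝ) → ℝ} (hf : DifferentiableAt ℝ f x)
    (hg : DifferentiableAt ℝ g x) (j : Fin 3) :
    pds3 (fun y => f y * g y) j x = f x * pds3 g j x + pds3 f j x * g x := by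
  simp only [pds3]
  rw [fderiv_fun_mul hf hg]
  simp [mul_comm]

lemma pds3_sub {f g : (Fin 3 → ℝ) → ℝ} (hf : DifferentiableAt ℝ f x)
    (hg : DifferentiableAt ℝ g x) (j : Fin 3) :
    pds3 (fun y => f y - g y) j x = pds3 f j x - pds3 g j x := by
  simp only [pds3]
  rw [fderiv_fun_sub hf hg]
  simp

lemma pds3_sum_mul (hA : DifferentiableAt ℝ A x) (hB : DifferentiableAt ℝ B x) (j : Fin 3) :
    pds3 (fun y => ∑ i, A y i * B y i) j x
      = ∑ i, (A x i * pd3 B j x i + pd3 A j x i * B x i) := by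
  have hA' := differentiableAt_pi.1 hA
  have hB' := differentiableAt_pi.1 hB
  have h : pds3 (fun y => ∑ i, A y i * B y i) j x
      = ∑ i, pds3 (fun y => A y i * B y i) j x := by
    simp only [pds3]
    rw [fderiv_fun_sum fun i _ => (hA' i).fun_mul (hB' i)]
    simp
  rw [h]
  refine Finset.sum_congr rfl fun i _ => ?_
  rw [pds3_mul (hA' i) (hB' i), pd3_apply hA, pd3_apply hB]

lemma differentiableAt_cross3 (hA : DifferentiableAt ℝ A x) (hB : DifferentiableAt ℝ B x) :
    DifferentiableAt ℝ (fun y => cross3 (A y) (B y)) x := by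
  have hA' := differentiableAt_pi.1 hA
  have hB' := differentiableAt_pi.1 hB
  refine differentiableAt_pi.2 fun i => ?_
  fin_cases i <;> simp [cross3] <;> fun_prop

lemma pd3_cross3 (hA : DifferentiableAt ℝ A x) (hB : DifferentiableAt ℝ B x) (j : Fin 3) :
    pd3 (fun y => cross3 (A y) (B y)) j x
      = cross3 (pd3 A j x) (B x) + cross3 (A x) (pd3 B j x) := by
  have hA' := differentiableAt_pi.1 hA
  have hB' := differentiableAt_pi.1 hB
  have key (k l : Fin 3) : pds3 (fun y => A y k * B y l - A y l * B y k) j x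
      = (pd3 A j x k * B x l - pd3 A j x l * B x k)
        + (A x k * pd3 B j x l - A x l * pd3 B j x k) := by
    rw [pds3_sub ((hA' k).fun_mul (hB' l)) ((hA' l).fun_mul (hB' k)), pds3_mul (hA' k) (hB' l),
      pds3_mul (hA' l) (hB' k)]
    simp only [pd3_apply hA, pd3_apply hB]
    ring
  ext i
  rw [pd3_apply (differentiableAt_cross3 hA hB)]
  fin_cases i
  · exact key 1 2
  · exact key 2 0
  · exact key 0 1

/-- `∇·(A×B) = B·(∇×A) − A·(∇×B)`. -/
lemma div3_cross3 (hA : DifferentiableAt ℝ A x) (hB : DifferentiableAt ℝ B x) :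
    div3 (fun y => cross3 (A y) (B y)) x
      = ∑ i, B x i * curl3 A x i - ∑ i, A x i * curl3 B x i := by
  simp only [div3, pd3_cross3 hA hB, Fin.sum_univ_three, Pi.add_apply]
  simp [cross3, curl3]
  ring

/-- `∇·(fF) = f ∇·F + F·∇f`. -/
lemma div3_smul_field (hf : DifferentiableAt ℝ f x) (hF : DifferentiableAt ℝ F x) :
    div3 (fun y => f y • F y) x = f x * div3 F x + ∑ j, F x j * pds3 f j x := by
  simp only [div3, pd3, pds3, Finset.mul_sum, ← Finset.sum_add_distrib]
  refine Finset.sum_congr rfl fun j _ => ?_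
  rw [fderiv_fun_smul hf hF]
  simp [mul_comm]

lemma div3_const_smul (c : ℝ) (hF : DifferentiableAt ℝ F x) :
    div3 (fun y => c • F y) x = c * div3 F x := by
  simp only [div3, pd3, Finset.mul_sum]
  rw [fderiv_fun_const_smul hF]
  simp

lemma div3_add (hF : DifferentiableAt ℝ F x) (hG : DifferentiableAt ℝ G x) :
    div3 (fun y => F y + G y) x = div3 F x + div3 G x := by
  simp only [div3, pd3, ← Finset.sum_add_distrib]
  rw [fderiv_fun_add hF hG]
  simp

lemma contDiff_pd3 (hF : ContDiff ℝ ∞ F) (j : Fin 3) : ContDiff ℝ ∞ (fun y => pd3 F j y) :=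
  (hF.fderiv_right (m := ∞) (by simp)).clm_apply contDiff_const

lemma contDiff_curl3 (hF : ContDiff ℝ ∞ F) : ContDiff ℝ ∞ (fun y => curl3 F y) := by
  have h (i j : Fin 3) : ContDiff ℝ ∞ (fun y => pd3 F j y i) :=
    contDiff_pi.1 (contDiff_pd3 hF j) i
  refine contDiff_pi.2 fun i => ?_
  fin_cases i
  · exact (h 2 1).sub (h 1 2)
  · exact (h 0 2).sub (h 2 0)
  · exact (h 1 0).sub (h 0 1)

lemma contDiff_cross3 (hA : ContDiff ℝ ∞ A) (hB : ContDiff ℝ ∞ B) :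
    ContDiff ℝ ∞ (fun y => cross3 (A y) (B y)) := by
  have hA' := contDiff_pi.1 hA
  have hB' := contDiff_pi.1 hB
  refine contDiff_pi.2 fun i => ?_
  fin_cases i
  · exact ((hA' 1).mul (hB' 2)).sub ((hA' 2).mul (hB' 1))
  · exact ((hA' 2).mul (hB' 0)).sub ((hA' 0).mul (hB' 2))
  · exact ((hA' 0).mul (hB' 1)).sub ((hA' 1).mul (hB' 0))

lemma contDiff_sum_mul_pd3 (hF : ContDiff ℝ ∞ F) :
    ContDiff ℝ ∞ (fun y j => ∑ i, F y i * pd3 F j y i) :=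
  contDiff_pi.2 fun j => ContDiff.sum fun i _ =>
    (contDiff_pi.1 hF i).mul (contDiff_pi.1 (contDiff_pd3 hF j) i)

/-- The field `F·∂ⱼF` has divergence `F·ΔF + |∇F|²`. -/
lemma div3_sum_mul_pd3 (hF : ContDiff ℝ ∞ F) :
    div3 (fun y j => ∑ i, F y i * pd3 F j y i) x
      = ∑ i, F x i * lap3 F x i + ∑ j, ∑ i, pd3 F j x i ^ 2 := by
  have hd : DifferentiableAt ℝ F x := (hF.differentiable (by simp)) x
  simp only [div3]
  have h (j : Fin 3) : pd3 (fun y k => ∑ i, F y i * pd3 F k y i) j x j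
      = ∑ i, (F x i * pd3 (fun y => pd3 F j y) j x i + pd3 F j x i * pd3 F j x i) := by
    rw [pd3_apply ((contDiff_sum_mul_pd3 hF).differentiable (by simp) x)]
    exact pds3_sum_mul hd ((contDiff_pd3 hF j).differentiable (by simp) x) j
  rw [Finset.sum_congr rfl fun j _ => h j]
  simp only [lap3, Fin.sum_univ_three]
  ring

/-- The integral of the divergence of a compactly supported field vanishes. -/
lemma integral_div3_eq_zero (hF : ContDiff ℝ ∞ F) (hc : HasCompactSupport F) :
    Integrable (fun x => div3 F x) ∧ ∫ x, div3 F x = 0 := by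
  have hint (j : Fin 3) : Integrable (fun x => pd3 F j x j) := by
    refine Continuous.integrable_of_hasCompactSupport
      ((continuous_apply j).comp (contDiff_pd3 hF j).continuous) ?_
    exact (hc.fderiv ℝ).mono' fun x hx => subset_tsupport _ fun h => hx (by simp [pd3, h])
  have hF' (j : Fin 3) : Integrable (fun x => F x j) :=
    Continuous.integrable_of_hasCompactSupport
      ((continuous_apply j).comp hF.continuous) (hc.comp_left (g := fun v : Fin 3 → ℝ => v j) rfl)
  have hd : Differentiable ℝ F := hF.differentiable (by simp)
  refine ⟨integrable_finsetSum _ fun j _ => hint j, ?_⟩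
  simp only [div3]
  rw [integral_finsetSum _ fun j _ => hint j]
  refine Finset.sum_eq_zero fun j _ => ?_
  have hp (y : Fin 3 → ℝ) : fderiv ℝ (fun y => F y j) y (Pi.single j 1) = pd3 F j y j :=
    (pd3_apply (hd y) j j).symm
  have := integral_mul_fderiv_eq_neg_fderiv_mul_of_integrable (μ := volume)
    (f := fun _ : Fin 3 → ℝ => (1 : ℝ)) (g := fun y => F y j) (v := Pi.single j 1)
    (by simp) (by simpa [hp] using hint j) (by simpa using hF' j)
    (fun _ _ => differentiableAt_const _) (fun y _ => differentiableAt_pi.1 (hd y) j)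
  simpa [hp] using this

end VectorCalculus

/-- Differentiation under the integral sign for a smooth integrand supported in a fixed compact
set. -/
lemma hasDerivAt_integral_of_support_subset {E : Type*} [NormedAddCommGroup E] [NormedSpace ℝ E]
    [MeasurableSpace E] [BorelSpace E] [SecondCountableTopology E] {m : Measure E}
    [IsFiniteMeasureOnCompacts m] {K : Set E} (hK : IsCompact K) {e : ℝ → E → ℝ}
    (he : ContDiff ℝ ∞ (fun q : ℝ × E => e q.1 q.2)) (hs : ∀ t, ∀ x ∉ K, e t x = 0) (t : ℝ) :
    Integrable (fun x => deriv (fun s => e s x) t) m ∧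
      HasDerivAt (fun s => ∫ x, e s x ∂m) (∫ x, deriv (fun s => e s x) t ∂m) t := by
  have hcont (s : ℝ) : Continuous (e s) := he.continuous.comp (by fun_prop : Continuous (Prod.mk s))
  have hdiff (s : ℝ) (x : E) : HasDerivAt (fun r => e r x)
      (fderiv ℝ (fun q : ℝ × E => e q.1 q.2) (s, x) (1, 0)) s := by
    have h1 := ((he.differentiable (by simp)) (s, x)).hasFDerivAt
    exact h1.comp_hasDerivAt s ((hasDerivAt_id s).prodMk (hasDerivAt_const s x))
  have hderiv : (fun q : ℝ × E => deriv (fun r => e r q.2) q.1)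
      = fun q => fderiv ℝ (fun q : ℝ × E => e q.1 q.2) q (1, 0) :=
    funext fun q => (hdiff q.1 q.2).deriv
  have hdc : Continuous (fun q : ℝ × E => deriv (fun r => e r q.2) q.1) := by
    rw [hderiv]
    exact (he.continuous_fderiv (by simp)).clm_apply continuous_const
  have hz (s : ℝ) (x : E) (hx : x ∉ K) : deriv (fun r => e r x) s = 0 := by
    simp [hs _ x hx]
  obtain ⟨C, hC⟩ := ((isCompact_Icc (a := t - 1) (b := t + 1)).prod hK).exists_bound_of_continuousOn
    hdc.continuousOn
  refine hasDerivAt_integral_of_dominated_loc_of_deriv_le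
    (F' := fun s x => deriv (fun r => e r x) s) (bound := K.indicator fun _ => C)
    (Icc_mem_nhds (by linarith : t - 1 < t) (by linarith : t < t + 1))
    (.of_forall fun s => (hcont s).aestronglyMeasurable)
    ((hcont t).integrable_of_hasCompactSupport (.intro hK (hs t)))
    (hdc.comp (by fun_prop : Continuous (Prod.mk t))).aestronglyMeasurable
    (.of_forall fun x s hst => ?_)
    ((integrable_indicator_iff hK.measurableSet).2
      (integrableOn_const hK.measure_lt_top.ne))
    (.of_forall fun x s _ => by simpa only [(hdiff s x).deriv] using hdiff s x)
  by_cases hx : x ∈ K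
  · simpa [hx] using hC (s, x) ⟨hst, hx⟩
  · simp [hx, hz s x hx]

/-- The energy flux of the MHD system: its divergence is the sum of the rate of change of the
energy density and the dissipation. -/
noncomputable def mhdFlux (μ σ ν : ℝ) (H u : (Fin 3 → ℝ) → (Fin 3 → ℝ)) (p : (Fin 3 → ℝ) → ℝ)
    (y : Fin 3 → ℝ) : Fin 3 → ℝ :=
  (-σ⁻¹) • cross3 (curl3 H y) (H y) + (μ • cross3 (cross3 (u y) (H y)) (H y)
    + (ν • (fun j => ∑ i, u y i * pd3 u j y i)
    + (-1 : ℝ) • (((1 / 2) * ∑ i, u y i * u y i + p y) • u y)))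

section Flux

variable {μ σ ν : ℝ} {H u : (Fin 3 → ℝ) → (Fin 3 → ℝ)} {p : (Fin 3 → ℝ) → ℝ}

lemma contDiff_bernoulli (hu : ContDiff ℝ ∞ u) (hp : ContDiff ℝ ∞ p) :
    ContDiff ℝ ∞ (fun y => (1 / 2) * ∑ i, u y i * u y i + p y) :=
  (contDiff_const.mul (ContDiff.sum fun i _ =>
    (contDiff_pi.1 hu i).mul (contDiff_pi.1 hu i))).add hp

lemma contDiff_mhdFlux (hH : ContDiff ℝ ∞ H) (hu : ContDiff ℝ ∞ u) (hp : ContDiff ℝ ∞ p) :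
    ContDiff ℝ ∞ (mhdFlux μ σ ν H u p) :=
  ((contDiff_cross3 (contDiff_curl3 hH) hH).const_smul (-σ⁻¹)).add
    (((contDiff_cross3 (contDiff_cross3 hu hH) hH).const_smul μ).add
      (((contDiff_sum_mul_pd3 hu).const_smul ν).add
        (((contDiff_bernoulli hu hp).smul hu).const_smul (-1 : ℝ))))

lemma mhdFlux_eq_zero {x : Fin 3 → ℝ} (hH : H x = 0) (hu : u x = 0) :
    mhdFlux μ σ ν H u p x = 0 := by
  have h (a : Fin 3 → ℝ) : cross3 a 0 = 0 := by
    ext i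
    fin_cases i <;> simp [cross3]
  ext i
  simp [mhdFlux, hH, hu, h]

lemma div3_mhdFlux (hH : ContDiff ℝ ∞ H) (hu : ContDiff ℝ ∞ u) (hp : ContDiff ℝ ∞ p)
    (x : Fin 3 → ℝ) :
    div3 (mhdFlux μ σ ν H u p) x =
      -σ⁻¹ * (∑ i, H x i * curl3 (fun y => curl3 H y) x i - ∑ i, curl3 H x i * curl3 H x i)
      + μ * (∑ i, H x i * curl3 (fun y => cross3 (u y) (H y)) x i
          - ∑ i, cross3 (u x) (H x) i * curl3 H x i)
      + ν * (∑ i, u x i * lap3 u x i + ∑ j, ∑ i, pd3 u j x i ^ 2)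
      - (((1 / 2) * ∑ i, u x i * u x i + p x) * div3 u x
          + ∑ j, u x j * (∑ i, u x i * pd3 u j x i + pds3 p j x)) := by
  have d {V : Type} [NormedAddCommGroup V] [NormedSpace ℝ V] {f : (Fin 3 → ℝ) → V}
      (hf : ContDiff ℝ ∞ f) : DifferentiableAt ℝ f x := hf.differentiable (by simp) x
  have h1 := contDiff_cross3 (contDiff_curl3 hH) hH
  have h2 := contDiff_cross3 (contDiff_cross3 hu hH) hH
  have h3 := contDiff_sum_mul_pd3 hu
  have hb := contDiff_bernoulli hu hp
  have h4 : ContDiff ℝ ∞ (fun y => ((1 / 2) * ∑ i, u y i * u y i + p y) • u y) := hb.smul hu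
  have hgrad (j : Fin 3) : pds3 (fun y => (1 / 2) * ∑ i, u y i * u y i + p y) j x
      = ∑ i, u x i * pd3 u j x i + pds3 p j x := by
    have hq : DifferentiableAt ℝ (fun y => ∑ i, u y i * u y i) x :=
      d (ContDiff.sum fun i _ => (contDiff_pi.1 hu i).mul (contDiff_pi.1 hu i))
    have hs := pds3_sum_mul (d hu) (d hu) j
    have : pds3 (fun y => (1 / 2) * ∑ i, u y i * u y i + p y) j x
        = (1 / 2) * pds3 (fun y => ∑ i, u y i * u y i) j x + pds3 p j x := by
      simp only [pds3]
      rw [fderiv_fun_add (hq.const_mul _) (d hp), fderiv_const_mul hq]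
      simp
    rw [this, hs]
    simp only [Fin.sum_univ_three]
    ring
  have e1 := div3_cross3 (d (contDiff_curl3 hH)) (d hH)
  have e2 := div3_cross3 (d (contDiff_cross3 hu hH)) (d hH)
  have e3 := div3_sum_mul_pd3 (x := x) hu
  have e4 := div3_smul_field (d hb) (d hu)
  simp only [hgrad] at e4
  unfold mhdFlux
  rw [div3_add (d (h1.const_smul (-σ⁻¹)))
      (d ((h2.const_smul μ).add ((h3.const_smul ν).add (h4.const_smul (-1 : ℝ))))),
    div3_add (d (h2.const_smul μ)) (d ((h3.const_smul ν).add (h4.const_smul (-1 : ℝ)))),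
    div3_add (d (h3.const_smul ν)) (d (h4.const_smul (-1 : ℝ))),
    div3_const_smul _ (d h1), div3_const_smul _ (d h2), div3_const_smul _ (d h3),
    div3_const_smul _ (d h4), e1, e2, e3, e4]
  ring

end Flux

/-- Energy decay for smooth, spatially compactly supported solutions of the
incompressible MHD system with zero sources: the total energy
`(μ/2)∫|H|² + (1/2)∫|u|²` is nonincreasing on `[0,T]`. -/
theorem mhd_energy_decay
    (T μ σ ν : ℝ) (hT : 0 < T) (hμ : 0 < μ) (hσ : 0 < σ) (hν : 0 < ν)
    (K : Set (Fin 3 → ℝ)) (hK : IsCompact K)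
    (H u : ℝ → (Fin 3 → ℝ) → (Fin 3 → ℝ)) (p : ℝ → (Fin 3 → ℝ) → ℝ)
    (hH : ContDiff ℝ (⊤ : ℕ∞) (fun q : ℝ × (Fin 3 → ℝ) => H q.1 q.2))
    (hu : ContDiff ℝ (⊤ : ℕ∞) (fun q : ℝ × (Fin 3 → ℝ) => u q.1 q.2))
    (hp : ContDiff ℝ (⊤ : ℕ∞) (fun q : ℝ × (Fin 3 → ℝ) => p q.1 q.2))
    (hsuppH : ∀ t, ∀ x ∉ K, H t x = 0)
    (hsuppu : ∀ t, ∀ x ∉ K, u t x = 0)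
    (hsuppp : ∀ t, ∀ x ∉ K, p t x = 0)
    (heqH : ∀ t ∈ Set.Icc (0 : ℝ) T, ∀ x : Fin 3 → ℝ, ∀ i : Fin 3,
      μ * deriv (fun s => H s x i) t
        + σ⁻¹ * curl3 (fun y => curl3 (H t) y) x i
        - μ * curl3 (fun y => cross3 (u t y) (H t y)) x i
        = 0)
    (hequ : ∀ t ∈ Set.Icc (0 : ℝ) T, ∀ x : Fin 3 → ℝ, ∀ i : Fin 3,
      deriv (fun s => u s x i) t
        + (∑ j, u t x j * pd3 (u t) j x i)
        - ν * lap3 (u t) x i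
        + pds3 (p t) i x
        = -(μ * cross3 (H t x) (curl3 (H t) x) i))
    (hdiv : ∀ t ∈ Set.Icc (0 : ℝ) T, ∀ x : Fin 3 → ℝ, div3 (u t) x = 0) :
    AntitoneOn
      (fun s => (μ / 2) * (∫ x, ∑ i, H s x i ^ 2)
        + (1 / 2) * (∫ x, ∑ i, u s x i ^ 2))
      (Set.Icc (0 : ℝ) T) := by
  have hHt (t : ℝ) : ContDiff ℝ ∞ (H t) := hH.comp (contDiff_prodMk_right t)
  have hut (t : ℝ) : ContDiff ℝ ∞ (u t) := hu.comp (contDiff_prodMk_right t)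
  have hpt (t : ℝ) : ContDiff ℝ ∞ (p t) := hp.comp (contDiff_prodMk_right t)
  have hdiff {F : ℝ → (Fin 3 → ℝ) → (Fin 3 → ℝ)}
      (hF : ContDiff ℝ ∞ (fun q : ℝ × (Fin 3 → ℝ) => F q.1 q.2)) (t : ℝ) (x : Fin 3 → ℝ)
      (i : Fin 3) : DifferentiableAt ℝ (fun s => F s x i) t :=
    ((contDiff_pi.1 hF i).comp (contDiff_prodMk_left x)).differentiable (by simp) t
  have henergy {F : ℝ → (Fin 3 → ℝ) → (Fin 3 → ℝ)}
      (hF : ContDiff ℝ ∞ (fun q : ℝ × (Fin 3 → ℝ) => F q.1 q.2))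
      (hs : ∀ t, ∀ x ∉ K, F t x = 0) (t : ℝ) :
      Integrable (fun x => 2 * ∑ i, F t x i * deriv (fun s => F s x i) t) ∧
        HasDerivAt (fun s => ∫ x, ∑ i, F s x i ^ 2)
          (∫ x, 2 * ∑ i, F t x i * deriv (fun s => F s x i) t) t := by
    have hd (x : Fin 3 → ℝ) : deriv (fun s => ∑ i, F s x i ^ 2) t
        = 2 * ∑ i, F t x i * deriv (fun s => F s x i) t := by
      have h := HasDerivAt.fun_sum (u := Finset.univ)
        fun i _ => ((hdiff hF t x i).hasDerivAt).fun_pow 2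
      rw [h.deriv, Finset.mul_sum]
      refine Finset.sum_congr rfl fun i _ => ?_
      simp
      ring
    simpa only [hd] using hasDerivAt_integral_of_support_subset (m := volume) hK
      (e := fun s x => ∑ i, F s x i ^ 2)
      (ContDiff.sum fun i _ => (contDiff_pi.1 hF i).pow 2)
      (fun s x hx => by simp [hs s x hx]) t
  have hE (t : ℝ) := (((henergy hH hsuppH t).2.const_mul (μ / 2)).add
    ((henergy hu hsuppu t).2.const_mul (1 / 2)))
  refine antitoneOn_of_deriv_nonpos (convex_Icc 0 T)
    (fun t _ => (hE t).continuousAt.continuousWithinAt)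
    (fun t _ => (hE t).differentiableAt.differentiableWithinAt) fun t ht => ?_
  have ht' : t ∈ Set.Icc (0 : ℝ) T := interior_subset ht
  obtain ⟨hfi, hf0⟩ := integral_div3_eq_zero
    (contDiff_mhdFlux (μ := μ) (σ := σ) (ν := ν) (hHt t) (hut t) (hpt t))
    (.intro hK fun x hx => mhdFlux_eq_zero (hsuppH t x hx) (hsuppu t x hx))
  refine (hE t).deriv.trans_le ?_
  rw [← integral_const_mul, ← integral_const_mul,
    ← integral_add ((henergy hH hsuppH t).1.const_mul _) ((henergy hu hsuppu t).1.const_mul _),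
    ← hf0]
  refine integral_mono (((henergy hH hsuppH t).1.const_mul _).add
    ((henergy hu hsuppu t).1.const_mul _)) hfi fun x => ?_
  have hdis1 : 0 ≤ σ⁻¹ * ∑ i, curl3 (H t) x i * curl3 (H t) x i :=
    mul_nonneg (inv_pos.2 hσ).le (Finset.sum_nonneg fun i _ => mul_self_nonneg _)
  have hdis2 : 0 ≤ ν * ∑ j, ∑ i, pd3 (u t) j x i ^ 2 :=
    mul_nonneg hν.le (Finset.sum_nonneg fun j _ => Finset.sum_nonneg fun i _ => sq_nonneg _)
  have hcross : ∑ i, cross3 (u t x) (H t x) i * curl3 (H t) x i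
      = ∑ i, u t x i * cross3 (H t x) (curl3 (H t) x) i := by
    simp only [Fin.sum_univ_three]
    simp [cross3]
    ring
  have hHi := fun i => heqH t ht' x i
  have hui := fun i => hequ t ht' x i
  have hbal : μ / 2 * (2 * ∑ i, H t x i * deriv (fun s => H s x i) t)
      + 1 / 2 * (2 * ∑ i, u t x i * deriv (fun s => u s x i) t)
      = div3 (mhdFlux μ σ ν (H t) (u t) (p t)) x
        - σ⁻¹ * ∑ i, curl3 (H t) x i * curl3 (H t) x i
        - ν * ∑ j, ∑ i, pd3 (u t) j x i ^ 2 := by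
    rw [div3_mhdFlux (hHt t) (hut t) (hpt t), hdiv t ht' x, hcross]
    simp only [Fin.sum_univ_three] at hui ⊢
    linear_combination H t x 0 * hHi 0 + H t x 1 * hHi 1 + H t x 2 * hHi 2
      + u t x 0 * hui 0 + u t x 1 * hui 1 + u t x 2 * hui 2
  change _ ≤ div3 (mhdFlux μ σ ν (H t) (u t) (p t)) x
  refine hbal.trans_le ?_
  linarith
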